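/- For every γ ≥ 1 there exists a constant C such that for every nondegenerate triangle K ⊂ ℝ² with shape-regularity ratio h_K/ρ_K ≤ γ and every continuously differentiable vector field E on a neighborhood of K, the Nédélec interpolation error satisfies ‖E − Π_K E‖_{L²(K)} ≤ C h_K ‖E‖_{H¹(K)}. -/

import Mathlib

open MeasureTheory

/-- Euclidean scalar product on ℝ². -/
noncomputable def dot (u v : ℝ × ℝ) : ℝ := u.1 * v.1 + u.2 * v.2

/-- Squared Euclidean norm on ℝ². -/
noncomputable def sq2 (u : ℝ × ℝ) : ℝ := u.1 ^ 2 + u.2 ^ 2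

/-- Euclidean diameter of a set in ℝ². -/
noncomputable def ediam (K : Set (ℝ × ℝ)) : ℝ :=
  sSup {d : ℝ | ∃ u ∈ K, ∃ v ∈ K, d = Real.sqrt (dot (u - v) (u - v))}

/-- Euclidean inradius: supremum of radii of (closed Euclidean) balls contained in `K`. -/
noncomputable def einrad (K : Set (ℝ × ℝ)) : ℝ :=
  sSup {r : ℝ | 0 ≤ r ∧ ∃ x : ℝ × ℝ, {y | Real.sqrt (dot (y - x) (y - x)) ≤ r} ⊆ K}

/-- Edge functional: `∫_e v ⬝ t ds = ∫_0^1 v(q₀ + s(q₁−q₀)) ⬝ (q₁−q₀) ds`. -/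
noncomputable def edgeInt (v : ℝ × ℝ → ℝ × ℝ) (q₀ q₁ : ℝ × ℝ) : ℝ :=
  ∫ s in (0 : ℝ)..1, dot (v (q₀ + s • (q₁ - q₀))) (q₁ - q₀)

/-- The reference triangle with vertices `(0, 0)`, `(1, 0)`, `(0, 1)`. -/
def refTriangle : Set (ℝ × ℝ) := {x | 0 ≤ x.1 ∧ 0 ≤ x.2 ∧ x.1 + x.2 ≤ 1}

lemma isClosed_refTriangle : IsClosed refTriangle := by
  unfold refTriangle
  simp only [Set.ofPred_and]
  exact (isClosed_le (by fun_prop) (by fun_prop)).inter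
    ((isClosed_le (by fun_prop) (by fun_prop)).inter (isClosed_le (by fun_prop) (by fun_prop)))

lemma isCompact_refTriangle : IsCompact refTriangle := by
  refine (isCompact_Icc (a := ((0 : ℝ), (0 : ℝ))) (b := (1, 1))).of_isClosed_subset
    isClosed_refTriangle ?_
  rintro ⟨s, t⟩ ⟨h1, h2, h3⟩
  simp only [Set.mem_Icc, Prod.mk_le_mk] at *
  exact ⟨⟨h1, h2⟩, by linarith, by linarith⟩

lemma Continuous.integrableOn_refTriangle {h : ℝ × ℝ → ℝ} (hh : Continuous h) :
    IntegrableOn h refTriangle :=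
  hh.continuousOn.integrableOn_compact isCompact_refTriangle

lemma convex_refTriangle : Convex ℝ refTriangle := by
  rintro ⟨s, t⟩ ⟨h1, h2, h3⟩ ⟨s', t'⟩ ⟨h1', h2', h3'⟩ a b ha hb hab
  simp only [refTriangle, Set.mem_ofPred_eq, Prod.smul_mk, Prod.mk_add_mk, smul_eq_mul] at *
  exact ⟨by positivity, by positivity, by nlinarith⟩

/-- Fubini on the reference triangle, integrating first in the second variable. -/
lemma setIntegral_refTriangle {h : ℝ × ℝ → ℝ} (hh : Continuous h) :
    ∫ x in refTriangle, h x = ∫ s in (0 : ℝ)..1, ∫ t in (0 : ℝ)..(1 - s), h (s, t) := by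
  have hm := isClosed_refTriangle.measurableSet
  rw [← integral_indicator hm, Measure.volume_eq_prod, integral_prod _
    (by rw [← Measure.volume_eq_prod]
        exact (integrable_indicator_iff hm).2 hh.integrableOn_refTriangle),
    intervalIntegral.integral_of_le zero_le_one, ← integral_Icc_eq_integral_Ioc,
    ← integral_indicator measurableSet_Icc]
  congr 1 with s
  by_cases hs : s ∈ Set.Icc (0 : ℝ) 1
  · rw [Set.indicator_of_mem hs, intervalIntegral.integral_of_le (by linarith [hs.2]),
      ← integral_Icc_eq_integral_Ioc, ← integral_indicator measurableSet_Icc]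
    congr 1 with t
    classical
    simp only [Set.indicator_apply]
    exact if_congr ⟨fun h => ⟨h.2.1, by linarith [h.2.2]⟩,
      fun h => ⟨hs.1, h.1, by linarith [h.2]⟩⟩ rfl rfl
  · rw [Set.indicator_of_notMem hs]
    refine integral_eq_zero_of_ae (Filter.Eventually.of_forall fun t => ?_)
    refine Set.indicator_of_notMem (fun h => hs ?_) _
    exact ⟨h.1, by linarith [h.2.1, h.2.2]⟩

lemma setIntegral_refTriangle_comp_swap (h : ℝ × ℝ → ℝ) :
    ∫ x in refTriangle, h x.swap = ∫ x in refTriangle, h x := by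
  have key := (Measure.measurePreserving_swap (μ := (volume : Measure ℝ))
    (ν := (volume : Measure ℝ))).setIntegral_preimage_emb
    MeasurableEquiv.prodComm.measurableEmbedding h refTriangle
  have hpre : Prod.swap ⁻¹' refTriangle = refTriangle := by
    ext ⟨s, t⟩
    simp only [refTriangle, Set.mem_preimage, Set.mem_ofPred_eq, Prod.swap_prod_mk]
    constructor <;> rintro ⟨h1, h2, h3⟩ <;> exact ⟨h2, h1, by linarith⟩
  rw [hpre] at key
  exact key

/-- Fubini on the reference triangle, integrating first in the first variable. -/
lemma setIntegral_refTriangle' {h : ℝ × ℝ → ℝ} (hh : Continuous h) :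
    ∫ x in refTriangle, h x = ∫ t in (0 : ℝ)..1, ∫ s in (0 : ℝ)..(1 - t), h (s, t) := by
  rw [← setIntegral_refTriangle_comp_swap,
    setIntegral_refTriangle (h := fun x => h x.swap) (by fun_prop)]
  rfl

lemma setIntegral_refTriangle_const (c : ℝ) : ∫ _ in refTriangle, c = c / 2 := by
  rw [setIntegral_refTriangle (h := fun _ => c) (by fun_prop)]
  simp [intervalIntegral.integral_comp_sub_left (fun x => x)]
  ring

lemma volume_real_refTriangle : (volume : Measure (ℝ × ℝ)).real refTriangle = 1 / 2 := by
  simpa using setIntegral_refTriangle_const 1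

/-- Cauchy–Schwarz against the constant function on a space of mass at most one. -/
lemma sq_integral_le_integral_sq {X : Type*} [MeasurableSpace X] {μ : Measure X}
    [IsFiniteMeasure μ] (hμ : μ.real Set.univ ≤ 1) {g : X → ℝ} (hg : Integrable g μ)
    (hg2 : Integrable (fun x => g x ^ 2) μ) : (∫ x, g x ∂μ) ^ 2 ≤ ∫ x, g x ^ 2 ∂μ := by
  set m := ∫ x, g x ∂μ with hm
  have h0 : 0 ≤ ∫ x, (g x ^ 2 - 2 * m * g x + m ^ 2) ∂μ :=
    integral_nonneg fun x => by simp only [Pi.zero_apply]; nlinarith [sq_nonneg (g x - m)]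
  have h1 : Integrable (fun x => g x ^ 2 - 2 * m * g x) μ := hg2.sub (hg.const_mul _)
  rw [integral_add h1 (integrable_const _), integral_sub hg2 (hg.const_mul _),
    integral_const_mul, integral_const, smul_eq_mul, ← hm] at h0
  nlinarith [sq_nonneg m]

lemma sq_setIntegral_refTriangle_le {g : ℝ × ℝ → ℝ} (hg : Continuous g) :
    (∫ x in refTriangle, g x) ^ 2 ≤ ∫ x in refTriangle, g x ^ 2 := by
  have : IsFiniteMeasure ((volume : Measure (ℝ × ℝ)).restrict refTriangle) :=
    isFiniteMeasure_restrict.2 isCompact_refTriangle.measure_lt_top.ne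
  refine sq_integral_le_integral_sq ?_ hg.integrableOn_refTriangle
    (hg.pow 2).integrableOn_refTriangle
  rw [measureReal_restrict_apply_univ, volume_real_refTriangle]
  norm_num

/-- On an interval of length at most one, the oscillation of a function is controlled by the
`L²` norm of its derivative. -/
lemma sq_sub_le_integral_sq_deriv {f f' : ℝ → ℝ} (hf : ∀ x, HasDerivAt f (f' x) x)
    (hf' : Continuous f') {L a b : ℝ} (hL : L ≤ 1) (ha : a ∈ Set.Icc 0 L)
    (hb : b ∈ Set.Icc 0 L) : (f a - f b) ^ 2 ≤ ∫ x in (0 : ℝ)..L, f' x ^ 2 := by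
  wlog hab : a ≤ b generalizing a b
  · have := this hb ha (le_of_not_ge hab)
    nlinarith
  have hL0 : 0 ≤ L := ha.1.trans ha.2
  have hftc : f b - f a = ∫ x in a..b, f' x :=
    (intervalIntegral.integral_eq_sub_of_hasDerivAt (fun x _ => hf x)
      (hf'.intervalIntegrable _ _)).symm
  have hcs : (∫ x in a..b, f' x) ^ 2 ≤ ∫ x in a..b, f' x ^ 2 := by
    rw [intervalIntegral.integral_of_le hab, intervalIntegral.integral_of_le hab]
    refine sq_integral_le_integral_sq ?_ (hf'.intervalIntegrable a b).1
      ((hf'.pow 2).intervalIntegrable a b).1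
    rw [measureReal_restrict_apply_univ, Real.volume_real_Ioc_of_le hab]
    linarith [ha.1, hb.2]
  have hmono : ∫ x in a..b, f' x ^ 2 ≤ ∫ x in (0 : ℝ)..L, f' x ^ 2 :=
    intervalIntegral.integral_mono_interval ha.1 hab hb.2
      (Filter.Eventually.of_forall fun x => sq_nonneg _) ((hf'.pow 2).intervalIntegrable _ _)
  calc (f a - f b) ^ 2 = (f b - f a) ^ 2 := by ring
    _ ≤ _ := by rw [hftc]; exact hcs.trans hmono

/-- Integration of an `x`-derivative over the reference triangle. -/
lemma setIntegral_refTriangle_deriv_fst {f fs : ℝ × ℝ → ℝ} (hfs : Continuous fs)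
    (hf : ∀ s t, HasDerivAt (fun σ => f (σ, t)) (fs (s, t)) s) :
    ∫ x in refTriangle, fs x = ∫ t in (0 : ℝ)..1, (f (1 - t, t) - f (0, t)) := by
  rw [setIntegral_refTriangle' hfs]
  refine intervalIntegral.integral_congr fun t _ => ?_
  exact intervalIntegral.integral_eq_sub_of_hasDerivAt (fun s _ => hf s t)
    (Continuous.intervalIntegrable (by fun_prop) _ _)

/-- Integration of a `y`-derivative over the reference triangle. -/
lemma setIntegral_refTriangle_deriv_snd {f ft : ℝ × ℝ → ℝ} (hft : Continuous ft)
    (hf : ∀ s t, HasDerivAt (fun τ => f (s, τ)) (ft (s, t)) t) :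
    ∫ x in refTriangle, ft x = ∫ s in (0 : ℝ)..1, (f (s, 1 - s) - f (s, 0)) := by
  rw [setIntegral_refTriangle hft]
  refine intervalIntegral.integral_congr fun s _ => ?_
  exact intervalIntegral.integral_eq_sub_of_hasDerivAt (fun t _ => hf s t)
    (Continuous.intervalIntegrable (by fun_prop) _ _)

lemma setIntegral_refTriangle_slice_le {h : ℝ × ℝ → ℝ} (hh : Continuous h)
    (h0 : ∀ x, 0 ≤ h x) :
    ∫ x in refTriangle, (∫ t in (0 : ℝ)..(1 - x.1), h (x.1, t)) ≤ ∫ x in refTriangle, h x := by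
  have hA : Continuous fun s : ℝ => ∫ t in (0 : ℝ)..(1 - s), h (s, t) :=
    intervalIntegral.continuous_parametric_intervalIntegral_of_continuous
      (f := fun s t => h (s, t)) (by simpa [Function.uncurry_def] using hh) (by fun_prop)
  rw [setIntegral_refTriangle hh, setIntegral_refTriangle
    (h := fun x => ∫ t in (0 : ℝ)..(1 - x.1), h (x.1, t)) (hA.comp continuous_fst)]
  refine intervalIntegral.integral_mono_on zero_le_one ?_ (hA.intervalIntegrable _ _)
    fun s hs => ?_
  · refine Continuous.intervalIntegrable ?_ _ _
    simp only [intervalIntegral.integral_const]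
    fun_prop
  · simp only [intervalIntegral.integral_const, smul_eq_mul, sub_zero]
    have : 0 ≤ ∫ t in (0 : ℝ)..(1 - s), h (s, t) :=
      intervalIntegral.integral_nonneg (by linarith [hs.2]) fun t _ => h0 _
    nlinarith [hs.1]

/-- Poincaré inequality on the reference triangle, with explicit mean value term. -/
lemma poincare_refTriangle_mean {f fs ft : ℝ × ℝ → ℝ} (hf : Continuous f)
    (hfs : Continuous fs) (hft : Continuous ft)
    (hs : ∀ s t, HasDerivAt (fun σ => f (σ, t)) (fs (s, t)) s)
    (ht : ∀ s t, HasDerivAt (fun τ => f (s, τ)) (ft (s, t)) t) :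
    ∫ x in refTriangle, f x ^ 2 ≤
      2 * (∫ x in refTriangle, fs x ^ 2) + 2 * (∫ x in refTriangle, ft x ^ 2) +
        2 * (∫ x in refTriangle, f x) ^ 2 := by
  set A : ℝ → ℝ := fun t => ∫ s in (0 : ℝ)..(1 - t), fs (s, t) ^ 2 with hA
  set B : ℝ → ℝ := fun s => ∫ t in (0 : ℝ)..(1 - s), ft (s, t) ^ 2 with hB
  have hAc : Continuous A := intervalIntegral.continuous_parametric_intervalIntegral_of_continuous
    (f := fun t s => fs (s, t) ^ 2) (by simp only [Function.uncurry_def]; fun_prop) (by fun_prop)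
  have hBc : Continuous B := intervalIntegral.continuous_parametric_intervalIntegral_of_continuous
    (f := fun s t => ft (s, t) ^ 2) (by simp only [Function.uncurry_def]; fun_prop) (by fun_prop)
  have hA0 : ∀ t ≤ 1, 0 ≤ A t := fun t ht =>
    intervalIntegral.integral_nonneg (by linarith) fun _ _ => sq_nonneg _
  have hB0 : ∀ t ≤ 1, 0 ≤ B t := fun t ht =>
    intervalIntegral.integral_nonneg (by linarith) fun _ _ => sq_nonneg _
  have hAint : ∫ x in refTriangle, A x.2 ≤ ∫ x in refTriangle, fs x ^ 2 := by
    have h1 := setIntegral_refTriangle_slice_le (h := fun x => fs x.swap ^ 2) (by fun_prop)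
      fun _ => sq_nonneg _
    rw [setIntegral_refTriangle_comp_swap (fun x => fs x ^ 2)] at h1
    rw [← setIntegral_refTriangle_comp_swap]
    exact h1
  have hBint : ∫ x in refTriangle, B x.1 ≤ ∫ x in refTriangle, ft x ^ 2 :=
    setIntegral_refTriangle_slice_le (h := fun x => ft x ^ 2) (by fun_prop) fun _ => sq_nonneg _
  set G : ℝ × ℝ → ℝ := fun x => A x.2 + B x.1 with hG
  have hGc : Continuous G := by fun_prop
  have hrow : ∀ s s' t, (s, t) ∈ refTriangle → (s', t) ∈ refTriangle →
      (f (s, t) - f (s', t)) ^ 2 ≤ A t := fun s s' t h h' =>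
    sq_sub_le_integral_sq_deriv (L := 1 - t) (fun σ => hs σ t) (by fun_prop)
      (by linarith [h.2.1]) ⟨h.1, by linarith [h.2.2]⟩ ⟨h'.1, by linarith [h'.2.2]⟩
  have hcol : ∀ s t t', (s, t) ∈ refTriangle → (s, t') ∈ refTriangle →
      (f (s, t) - f (s, t')) ^ 2 ≤ B s := fun s t t' h h' =>
    sq_sub_le_integral_sq_deriv (L := 1 - s) (fun τ => ht s τ) (by fun_prop)
      (by linarith [h.1]) ⟨h.2.1, by linarith [h.2.2]⟩ ⟨h'.2.1, by linarith [h'.2.2]⟩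
  have hpt : ∀ x ∈ refTriangle, ∀ y ∈ refTriangle, (f x - f y) ^ 2 ≤ 2 * G x + 2 * G y := by
    rintro ⟨s, t⟩ hx ⟨s', t'⟩ hy
    obtain ⟨x1, x2, x3⟩ := id hx
    obtain ⟨y1, y2, y3⟩ := id hy
    simp only at x1 x2 x3 y1 y2 y3
    have e1 := hA0 t (by linarith)
    have e2 := hA0 t' (by linarith)
    have e3 := hB0 s (by linarith)
    have e4 := hB0 s' (by linarith)
    simp only [hG]
    by_cases hc : s' + t ≤ 1
    · have hz : (s', t) ∈ refTriangle := ⟨y1, x2, hc⟩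
      nlinarith [hrow s s' t hx hz, hcol s' t t' hz hy,
        sq_nonneg ((f (s, t) - f (s', t)) - (f (s', t) - f (s', t')))]
    · have hz : (s, t') ∈ refTriangle := ⟨x1, y2, by simp only; linarith⟩
      nlinarith [hcol s t t' hx hz, hrow s s' t' hz hy,
        sq_nonneg ((f (s, t) - f (s, t')) - (f (s, t') - f (s', t')))]
  set M := ∫ x in refTriangle, f x with hM
  set S := ∫ x in refTriangle, f x ^ 2 with hS
  set I := ∫ x in refTriangle, G x with hI
  have hTm := isClosed_refTriangle.measurableSet
  have hinner : ∀ x ∈ refTriangle, f x ^ 2 / 2 - 2 * M * f x + S ≤ G x + 2 * I := by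
    intro x hx
    have h1 : ∫ y in refTriangle, (f x ^ 2 - 2 * f x * f y + f y ^ 2) ≤
        ∫ y in refTriangle, (2 * G x + 2 * G y) :=
      setIntegral_mono_on (Continuous.integrableOn_refTriangle (by fun_prop))
        (Continuous.integrableOn_refTriangle (by fun_prop)) hTm
        fun y hy => by linarith [hpt x hx y hy, sub_sq (f x) (f y)]
    rw [integral_add (Continuous.integrableOn_refTriangle (by fun_prop))
        (Continuous.integrableOn_refTriangle (by fun_prop)),
      integral_sub (Continuous.integrableOn_refTriangle (by fun_prop))
        (Continuous.integrableOn_refTriangle (by fun_prop)),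
      integral_add (Continuous.integrableOn_refTriangle (by fun_prop))
        (Continuous.integrableOn_refTriangle (by fun_prop)),
      integral_const_mul, integral_const_mul 2 G, setIntegral_refTriangle_const,
      setIntegral_refTriangle_const, ← hM, ← hS, ← hI] at h1
    linarith
  have houter : ∫ x in refTriangle, (f x ^ 2 / 2 - 2 * M * f x + S) ≤
      ∫ x in refTriangle, (G x + 2 * I) :=
    setIntegral_mono_on (Continuous.integrableOn_refTriangle (by fun_prop))
      (Continuous.integrableOn_refTriangle (by fun_prop)) hTm hinner
  rw [integral_add (Continuous.integrableOn_refTriangle (by fun_prop))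
      (Continuous.integrableOn_refTriangle (by fun_prop)),
    integral_sub (Continuous.integrableOn_refTriangle (by fun_prop))
      (Continuous.integrableOn_refTriangle (by fun_prop)),
    integral_add (Continuous.integrableOn_refTriangle (by fun_prop))
      (Continuous.integrableOn_refTriangle (by fun_prop)),
    integral_const_mul, integral_div, setIntegral_refTriangle_const,
    setIntegral_refTriangle_const, ← hM, ← hS, ← hI] at houter
  have hIle : I = (∫ x in refTriangle, A x.2) + ∫ x in refTriangle, B x.1 :=
    integral_add (Continuous.integrableOn_refTriangle (by fun_prop))
      (Continuous.integrableOn_refTriangle (by fun_prop))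
  nlinarith

/-- Poincaré inequality on the reference triangle for functions with vanishing mean on the edge
`y = 0`. -/
lemma poincare_refTriangle_edge {f fs ft : ℝ × ℝ → ℝ} (hf : Continuous f)
    (hfs : Continuous fs) (hft : Continuous ft)
    (hs : ∀ s t, HasDerivAt (fun σ => f (σ, t)) (fs (s, t)) s)
    (ht : ∀ s t, HasDerivAt (fun τ => f (s, τ)) (ft (s, t)) t)
    (hedge : ∫ s in (0 : ℝ)..1, f (s, 0) = 0) :
    ∫ x in refTriangle, f x ^ 2 ≤
      3 * (∫ x in refTriangle, fs x ^ 2) + 3 * (∫ x in refTriangle, ft x ^ 2) := by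
  have hmean := poincare_refTriangle_mean hf hfs hft hs ht
  have h1 := setIntegral_refTriangle_deriv_fst (f := fun x => x.1 * f x)
    (fs := fun x => f x + x.1 * fs x) (by fun_prop)
    (fun s t => ((hasDerivAt_id s).mul (hs s t)).congr_deriv (by simp))
  have h2 := setIntegral_refTriangle_deriv_snd (f := fun x => (x.2 - 1) * f x)
    (ft := fun x => f x + (x.2 - 1) * ft x) (by fun_prop)
    (fun s t => (((hasDerivAt_id t).sub_const 1).mul (ht s t)).congr_deriv (by simp))
  have h3 := intervalIntegral.integral_comp_sub_left (a := 0) (b := 1)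
    (fun t => t * f (t, 1 - t)) 1
  simp only [sub_sub_cancel, sub_self, sub_zero] at h3
  rw [integral_add hf.integrableOn_refTriangle
    (Continuous.integrableOn_refTriangle (by fun_prop))] at h1 h2
  simp only [zero_mul, sub_zero] at h1
  rw [h3] at h1
  have h4 : ∫ s in (0 : ℝ)..1, ((1 - s - 1) * f (s, 1 - s) - (0 - 1) * f (s, 0)) =
      -(∫ s in (0 : ℝ)..1, s * f (s, 1 - s)) + ∫ s in (0 : ℝ)..1, f (s, 0) := by
    rw [← intervalIntegral.integral_neg, ← intervalIntegral.integral_add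
      (Continuous.intervalIntegrable (by fun_prop) _ _)
      (Continuous.intervalIntegrable (by fun_prop) _ _)]
    exact intervalIntegral.integral_congr fun s _ => by ring
  rw [h4, hedge] at h2
  set M := ∫ x in refTriangle, f x with hM
  have h5 : 2 * M = -∫ x in refTriangle, (x.1 * fs x + (x.2 - 1) * ft x) := by
    rw [integral_add (Continuous.integrableOn_refTriangle (by fun_prop))
      (Continuous.integrableOn_refTriangle (by fun_prop))]
    linarith
  have h6 := sq_setIntegral_refTriangle_le (g := fun x => x.1 * fs x + (x.2 - 1) * ft x)
    (by fun_prop)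
  have h7 : ∫ x in refTriangle, (x.1 * fs x + (x.2 - 1) * ft x) ^ 2 ≤
      ∫ x in refTriangle, (2 * fs x ^ 2 + 2 * ft x ^ 2) := by
    refine setIntegral_mono_on (Continuous.integrableOn_refTriangle (by fun_prop))
      (Continuous.integrableOn_refTriangle (by fun_prop)) isClosed_refTriangle.measurableSet ?_
    rintro ⟨s, t⟩ ⟨x1, x2, x3⟩
    simp only at *
    have a1 : s ^ 2 ≤ 1 := by nlinarith
    have a2 : (t - 1) ^ 2 ≤ 1 := by nlinarith
    nlinarith [sq_nonneg (s * fs (s, t) - (t - 1) * ft (s, t)),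
      mul_le_mul_of_nonneg_right a1 (sq_nonneg (fs (s, t))),
      mul_le_mul_of_nonneg_right a2 (sq_nonneg (ft (s, t)))]
  rw [integral_add (Continuous.integrableOn_refTriangle (by fun_prop))
    (Continuous.integrableOn_refTriangle (by fun_prop)), integral_const_mul,
    integral_const_mul] at h7
  have h8 : (2 * M) ^ 2 ≤ 2 * (∫ x in refTriangle, fs x ^ 2) +
      2 * ∫ x in refTriangle, ft x ^ 2 := by
    rw [h5, neg_sq]; exact h6.trans h7
  nlinarith

/-- Interpolation estimate on the reference triangle for a field `(f, g)` and the Nédélec field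
`(α - β y, κ + β x)` with the same edge integrals. -/
lemma nedelec_estimate_refTriangle {f fs ft g gs gt : ℝ × ℝ → ℝ} (hf : Continuous f)
    (hfs : Continuous fs) (hft : Continuous ft) (hg : Continuous g) (hgs : Continuous gs)
    (hgt : Continuous gt)
    (hs : ∀ s t, HasDerivAt (fun σ => f (σ, t)) (fs (s, t)) s)
    (ht : ∀ s t, HasDerivAt (fun τ => f (s, τ)) (ft (s, t)) t)
    (hs' : ∀ s t, HasDerivAt (fun σ => g (σ, t)) (gs (s, t)) s)
    (ht' : ∀ s t, HasDerivAt (fun τ => g (s, τ)) (gt (s, t)) t)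
    {F G : ℝ × ℝ → ℝ} {α β κ : ℝ} (hF : ∀ x, F x = f x - (α - β * x.2))
    (hG : ∀ x, G x = g x - (κ + β * x.1))
    (he₁ : ∫ s in (0 : ℝ)..1, F (s, 0) = 0) (he₂ : ∫ t in (0 : ℝ)..1, G (0, t) = 0)
    (he₃ : ∫ t in (0 : ℝ)..1, (G (1 - t, t) - F (1 - t, t)) = 0) :
    ∫ x in refTriangle, (F x ^ 2 + G x ^ 2) ≤
      18 * ∫ x in refTriangle, (fs x ^ 2 + ft x ^ 2 + gs x ^ 2 + gt x ^ 2) := by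
  have hFc : Continuous F := by rw [funext hF]; fun_prop
  have hGc : Continuous G := by rw [funext hG]; fun_prop
  have hFs : ∀ s t, HasDerivAt (fun σ => F (σ, t)) (fs (s, t)) s := fun s t => by
    simp only [hF]
    exact (hs s t).sub_const _
  have hFt : ∀ s t, HasDerivAt (fun τ => F (s, τ)) (ft (s, t) + β) t := fun s t => by
    simp only [hF]
    exact ((ht s t).sub (((hasDerivAt_id t).const_mul β).const_sub α)).congr_deriv (by ring)
  have hGs : ∀ s t, HasDerivAt (fun σ => G (σ, t)) (gs (s, t) - β) s := fun s t => by
    simp only [hG]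
    exact ((hs' s t).sub (((hasDerivAt_id s).const_mul β).const_add κ)).congr_deriv (by ring)
  have hGt : ∀ s t, HasDerivAt (fun τ => G (s, τ)) (gt (s, t)) t := fun s t => by
    simp only [hG]
    exact (ht' s t).sub_const _
  have hβ : β = (∫ x in refTriangle, gs x) - ∫ x in refTriangle, ft x := by
    have h1 := setIntegral_refTriangle_deriv_fst (f := G) (fs := fun x => gs x - β)
      (by fun_prop) hGs
    have h2 := setIntegral_refTriangle_deriv_snd (f := F) (ft := fun x => ft x + β)
      (by fun_prop) hFt
    have h3 := intervalIntegral.integral_comp_sub_left (a := 0) (b := 1)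
      (fun t => F (t, 1 - t)) 1
    simp only [sub_sub_cancel, sub_self, sub_zero] at h3
    rw [intervalIntegral.integral_sub (Continuous.intervalIntegrable (by fun_prop) _ _)
      (Continuous.intervalIntegrable (by fun_prop) _ _)] at h1 h2 he₃
    rw [integral_sub hgs.integrableOn_refTriangle
      (Continuous.integrableOn_refTriangle (by fun_prop)), setIntegral_refTriangle_const] at h1
    rw [integral_add hft.integrableOn_refTriangle
      (Continuous.integrableOn_refTriangle (by fun_prop)), setIntegral_refTriangle_const] at h2
    linarith
  have hβsq : β ^ 2 ≤ 2 * (∫ x in refTriangle, gs x ^ 2) + 2 * ∫ x in refTriangle, ft x ^ 2 := by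
    have h1 := sq_setIntegral_refTriangle_le hgs
    have h2 := sq_setIntegral_refTriangle_le hft
    rw [hβ]
    nlinarith [sq_nonneg ((∫ x in refTriangle, gs x) + ∫ x in refTriangle, ft x)]
  have hshift : ∀ {h : ℝ × ℝ → ℝ} (c : ℝ), Continuous h → c ^ 2 = β ^ 2 →
      ∫ x in refTriangle, (h x + c) ^ 2 ≤ 2 * (∫ x in refTriangle, h x ^ 2) + β ^ 2 := by
    intro h c hh hc
    have h1 : ∫ x in refTriangle, (h x + c) ^ 2 ≤
        ∫ x in refTriangle, (2 * h x ^ 2 + 2 * β ^ 2) :=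
      setIntegral_mono (Continuous.integrableOn_refTriangle (by fun_prop))
        (Continuous.integrableOn_refTriangle (by fun_prop))
        fun x => by simp only; nlinarith [sq_nonneg (h x - c)]
    rw [integral_add (Continuous.integrableOn_refTriangle (by fun_prop))
      (Continuous.integrableOn_refTriangle (by fun_prop)), integral_const_mul,
      setIntegral_refTriangle_const] at h1
    linarith
  have hPF := poincare_refTriangle_edge (ft := fun x => ft x + β) hFc hfs (by fun_prop) hFs hFt he₁
  have hPG := poincare_refTriangle_edge (f := fun x => G x.swap) (fs := fun x => gt x.swap)
    (ft := fun x => gs x.swap - β) (by fun_prop) (by fun_prop) (by fun_prop)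
    (fun s t => hGt t s) (fun s t => hGs t s) he₂
  rw [setIntegral_refTriangle_comp_swap (fun x => G x ^ 2),
    setIntegral_refTriangle_comp_swap (fun x => gt x ^ 2),
    setIntegral_refTriangle_comp_swap (fun x => (gs x - β) ^ 2)] at hPG
  have hb1 := hshift β hft rfl
  have hb2 := hshift (-β) hgs (neg_sq β)
  simp only [← sub_eq_add_neg] at hb2
  have n1 : 0 ≤ ∫ x in refTriangle, fs x ^ 2 := integral_nonneg fun _ => sq_nonneg _
  have n2 : 0 ≤ ∫ x in refTriangle, gt x ^ 2 := integral_nonneg fun _ => sq_nonneg _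
  rw [integral_add (Continuous.integrableOn_refTriangle (by fun_prop))
      (Continuous.integrableOn_refTriangle (by fun_prop)),
    integral_add (Continuous.integrableOn_refTriangle (by fun_prop))
      (Continuous.integrableOn_refTriangle (by fun_prop)),
    integral_add (Continuous.integrableOn_refTriangle (by fun_prop))
      (Continuous.integrableOn_refTriangle (by fun_prop)),
    integral_add (Continuous.integrableOn_refTriangle (by fun_prop))
      (Continuous.integrableOn_refTriangle (by fun_prop))]
  linarith

/-- The affine map sending the reference triangle to the triangle `p, p + u, p + v`. -/
def refMap (p u v x : ℝ × ℝ) : ℝ × ℝ := p + (x.1 • u + x.2 • v)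

/-- The linear part of `refMap`. -/
noncomputable def refMapLinear (u v : ℝ × ℝ) : ℝ × ℝ →L[ℝ] ℝ × ℝ :=
  (ContinuousLinearMap.fst ℝ ℝ ℝ).smulRight u + (ContinuousLinearMap.snd ℝ ℝ ℝ).smulRight v

lemma hasFDerivAt_refMap (p u v x : ℝ × ℝ) :
    HasFDerivAt (refMap p u v) (refMapLinear u v) x :=
  (refMapLinear u v).hasFDerivAt.const_add p

@[fun_prop]
lemma continuous_refMap (p u v : ℝ × ℝ) : Continuous (refMap p u v) := by
  unfold refMap; fun_prop

lemma refMap_injective {u v : ℝ × ℝ} (hD : u.1 * v.2 - u.2 * v.1 ≠ 0) (p : ℝ × ℝ) :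
    Function.Injective (refMap p u v) := by
  rintro ⟨s, t⟩ ⟨s', t'⟩ h
  have h' := add_left_cancel h
  have h1 := congrArg Prod.fst h'
  have h2 := congrArg Prod.snd h'
  simp only [Prod.fst_add, Prod.snd_add, Prod.smul_fst, Prod.smul_snd, smul_eq_mul] at h1 h2
  have e1 : s = s' := mul_right_cancel₀ hD (by linear_combination v.2 * h1 - v.1 * h2)
  have e2 : t = t' := mul_right_cancel₀ hD (by linear_combination u.1 * h2 - u.2 * h1)
  rw [e1, e2]

lemma setIntegral_image_refMap {u v : ℝ × ℝ} (hD : u.1 * v.2 - u.2 * v.1 ≠ 0) (p : ℝ × ℝ)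
    (h : ℝ × ℝ → ℝ) :
    ∫ x in refMap p u v '' refTriangle, h x =
      |(refMapLinear u v).det| * ∫ x in refTriangle, h (refMap p u v x) := by
  rw [integral_image_eq_integral_abs_det_fderiv_smul volume
    isClosed_refTriangle.measurableSet
    (fun x _ => (hasFDerivAt_refMap p u v x).hasFDerivWithinAt) (refMap_injective hD p).injOn]
  simp only [smul_eq_mul, integral_const_mul]

lemma hasDerivAt_refMap_fst (p u v : ℝ × ℝ) (s t : ℝ) :
    HasDerivAt (fun σ => refMap p u v (σ, t)) u s :=
  ((((hasDerivAt_id s).smul_const u).add_const (t • v)).const_add p).congr_deriv (one_smul ℝ u)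

lemma hasDerivAt_refMap_snd (p u v : ℝ × ℝ) (s t : ℝ) :
    HasDerivAt (fun τ => refMap p u v (s, τ)) v t :=
  ((((hasDerivAt_id t).smul_const v).const_add (s • u)).const_add p).congr_deriv (one_smul ℝ v)

lemma HasDerivAt.dot_const {γ : ℝ → ℝ × ℝ} {γ' : ℝ × ℝ} {s : ℝ} (h : HasDerivAt γ γ' s)
    (w : ℝ × ℝ) : HasDerivAt (fun σ => dot (γ σ) w) (dot γ' w) s := by
  have h1 : HasDerivAt (fun σ => (γ σ).1) γ'.1 s :=
    (ContinuousLinearMap.fst ℝ ℝ ℝ).hasFDerivAt.comp_hasDerivAt s h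
  have h2 : HasDerivAt (fun σ => (γ σ).2) γ'.2 s :=
    (ContinuousLinearMap.snd ℝ ℝ ℝ).hasFDerivAt.comp_hasDerivAt s h
  exact (h1.mul_const _).add (h2.mul_const _)

@[fun_prop]
lemma Continuous.dot {X : Type*} [TopologicalSpace X] {f g : X → ℝ × ℝ}
    (hf : Continuous f) (hg : Continuous g) : Continuous fun x => dot (f x) (g x) := by
  unfold _root_.dot; fun_prop

@[fun_prop]
lemma Continuous.sq2 {X : Type*} [TopologicalSpace X] {f : X → ℝ × ℝ}
    (hf : Continuous f) : Continuous fun x => sq2 (f x) := by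
  unfold _root_.sq2; fun_prop

lemma sq2_nonneg (w : ℝ × ℝ) : 0 ≤ sq2 w := by unfold sq2; positivity

lemma dot_sq_le (w a : ℝ × ℝ) : dot w a ^ 2 ≤ sq2 w * sq2 a := by
  unfold dot sq2; nlinarith [sq_nonneg (w.1 * a.2 - w.2 * a.1)]

/-- A vector is controlled by its components along two independent vectors. -/
lemma det_sq_mul_sq2_le {u v : ℝ × ℝ} {H : ℝ} (hu : sq2 u ≤ H) (hv : sq2 v ≤ H) (w : ℝ × ℝ) :
    (u.1 * v.2 - u.2 * v.1) ^ 2 * sq2 w ≤ 2 * H * (dot w u ^ 2 + dot w v ^ 2) := by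
  have h1 : (u.1 * v.2 - u.2 * v.1) ^ 2 * sq2 w ≤
      2 * sq2 v * dot w u ^ 2 + 2 * sq2 u * dot w v ^ 2 := by
    have : (u.1 * v.2 - u.2 * v.1) ^ 2 * sq2 w =
        (dot w u * v.2 - dot w v * u.2) ^ 2 + (dot w v * u.1 - dot w u * v.1) ^ 2 := by
      unfold sq2 dot; ring
    rw [this]
    unfold sq2
    nlinarith [sq_nonneg (dot w u * v.2 + dot w v * u.2),
      sq_nonneg (dot w v * u.1 + dot w u * v.1)]
  nlinarith [mul_le_mul_of_nonneg_right hu (sq_nonneg (dot w v)),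
    mul_le_mul_of_nonneg_right hv (sq_nonneg (dot w u))]

lemma dot_apply_sq_le (L : ℝ × ℝ →L[ℝ] ℝ × ℝ) {a c : ℝ × ℝ} {H : ℝ} (ha : sq2 a ≤ H)
    (hc : sq2 c ≤ H) :
    dot (L a) c ^ 2 ≤ H ^ 2 * (sq2 (L (1, 0)) + sq2 (L (0, 1))) := by
  have hL : L a = a.1 • L (1, 0) + a.2 • L (0, 1) := by
    rw [← map_smul, ← map_smul, ← map_add]
    simp
  have h1 : sq2 (L a) ≤ sq2 a * (sq2 (L (1, 0)) + sq2 (L (0, 1))) := by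
    rw [hL]
    generalize L (1, 0) = e
    generalize L (0, 1) = e'
    simp only [sq2, Prod.fst_add, Prod.snd_add, Prod.smul_fst, Prod.smul_snd, smul_eq_mul]
    nlinarith [sq_nonneg (a.1 * e'.1 - a.2 * e.1), sq_nonneg (a.1 * e'.2 - a.2 * e.2)]
  have hQ : 0 ≤ sq2 (L (1, 0)) + sq2 (L (0, 1)) := add_nonneg (sq2_nonneg _) (sq2_nonneg _)
  have hH : 0 ≤ H := (sq2_nonneg a).trans ha
  calc dot (L a) c ^ 2 ≤ sq2 (L a) * sq2 c := dot_sq_le _ _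
    _ ≤ (H * (sq2 (L (1, 0)) + sq2 (L (0, 1)))) * H :=
        mul_le_mul (h1.trans (mul_le_mul_of_nonneg_right ha hQ)) hc (sq2_nonneg _)
          (mul_nonneg hH hQ)
    _ = _ := by ring

/-- The interpolation estimate on the triangle `p, p + u, p + v`, in terms of the Jacobian
`u.1 * v.2 - u.2 * v.1` and a bound `H` for the squared edge lengths. -/
lemma nedelec_estimate_image {E PE : ℝ × ℝ → ℝ × ℝ} (hE : ContDiff ℝ 1 E) {a : ℝ × ℝ} {b : ℝ}
    (hPE : ∀ x : ℝ × ℝ, PE x = (a.1 - b * x.2, a.2 + b * x.1)) {p u v : ℝ × ℝ} {H : ℝ}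
    (hu : sq2 u ≤ H) (hv : sq2 v ≤ H) (hD : u.1 * v.2 - u.2 * v.1 ≠ 0)
    (he₁ : ∫ s in (0 : ℝ)..1, dot ((E - PE) (refMap p u v (s, 0))) u = 0)
    (he₂ : ∫ t in (0 : ℝ)..1, dot ((E - PE) (refMap p u v (0, t))) v = 0)
    (he₃ : ∫ t in (0 : ℝ)..1, dot ((E - PE) (refMap p u v (1 - t, t))) (v - u) = 0) :
    (u.1 * v.2 - u.2 * v.1) ^ 2 * ∫ x in refMap p u v '' refTriangle, sq2 (E x - PE x) ≤
      144 * H ^ 3 * ∫ x in refMap p u v '' refTriangle,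
        (sq2 (fderiv ℝ E x (1, 0)) + sq2 (fderiv ℝ E x (0, 1))) := by
  have hEc := hE.continuous
  have hPEc : Continuous PE := by rw [funext hPE]; fun_prop
  have hE' : Continuous (fderiv ℝ E) := hE.continuous_fderiv one_ne_zero
  have hE'w : ∀ w, Continuous fun x => fderiv ℝ E (refMap p u v x) w := fun w =>
    (hE'.comp (continuous_refMap p u v)).clm_apply continuous_const
  have hE'w1 := hE'w (1, 0)
  have hE'w2 := hE'w (0, 1)
  have hE'u := hE'w u
  have hE'v := hE'w v
  have hder : ∀ {γ : ℝ → ℝ × ℝ} {γ' : ℝ × ℝ} {s : ℝ}, HasDerivAt γ γ' s →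
      HasDerivAt (fun σ => E (γ σ)) (fderiv ℝ E (γ s) γ') s := fun {γ γ' s} h =>
    (hE.differentiable one_ne_zero (γ s)).hasFDerivAt.comp_hasDerivAt s h
  set D := u.1 * v.2 - u.2 * v.1 with hDdef
  have key := nedelec_estimate_refTriangle
    (f := fun x => dot (E (refMap p u v x)) u) (g := fun x => dot (E (refMap p u v x)) v)
    (fs := fun x => dot (fderiv ℝ E (refMap p u v x) u) u)
    (ft := fun x => dot (fderiv ℝ E (refMap p u v x) v) u)
    (gs := fun x => dot (fderiv ℝ E (refMap p u v x) u) v)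
    (gt := fun x => dot (fderiv ℝ E (refMap p u v x) v) v)
    (F := fun x => dot ((E - PE) (refMap p u v x)) u)
    (G := fun x => dot ((E - PE) (refMap p u v x)) v)
    (α := dot (PE p) u) (β := b * D) (κ := dot (PE p) v)
    (by fun_prop) (by fun_prop) (by fun_prop) (by fun_prop) (by fun_prop) (by fun_prop)
    (fun s t => (hder (hasDerivAt_refMap_fst p u v s t)).dot_const u)
    (fun s t => (hder (hasDerivAt_refMap_snd p u v s t)).dot_const u)
    (fun s t => (hder (hasDerivAt_refMap_fst p u v s t)).dot_const v)
    (fun s t => (hder (hasDerivAt_refMap_snd p u v s t)).dot_const v)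
    (fun x => by
      simp only [Pi.sub_apply, hPE, refMap, dot, hDdef, Prod.fst_sub, Prod.snd_sub, Prod.fst_add,
        Prod.snd_add, Prod.smul_fst, Prod.smul_snd, smul_eq_mul]
      ring)
    (fun x => by
      simp only [Pi.sub_apply, hPE, refMap, dot, hDdef, Prod.fst_sub, Prod.snd_sub, Prod.fst_add,
        Prod.snd_add, Prod.smul_fst, Prod.smul_snd, smul_eq_mul]
      ring)
    he₁ he₂
    (by
      refine Eq.trans ?_ he₃
      refine intervalIntegral.integral_congr fun t _ => ?_
      simp only [dot, Prod.fst_sub, Prod.snd_sub]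
      ring)
  rw [setIntegral_image_refMap hD, setIntegral_image_refMap hD]
  have hleft : D ^ 2 * ∫ x in refTriangle, sq2 (E (refMap p u v x) - PE (refMap p u v x)) ≤
      2 * H * ∫ x in refTriangle, (dot ((E - PE) (refMap p u v x)) u ^ 2 +
        dot ((E - PE) (refMap p u v x)) v ^ 2) := by
    rw [← integral_const_mul, ← integral_const_mul]
    have hEPE : Continuous (E - PE) := hEc.sub hPEc
    exact setIntegral_mono (Continuous.integrableOn_refTriangle (by fun_prop))
      (Continuous.integrableOn_refTriangle (by fun_prop))
      fun x => det_sq_mul_sq2_le hu hv _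
  have hright : ∫ x in refTriangle, (dot (fderiv ℝ E (refMap p u v x) u) u ^ 2 +
        dot (fderiv ℝ E (refMap p u v x) v) u ^ 2 + dot (fderiv ℝ E (refMap p u v x) u) v ^ 2 +
        dot (fderiv ℝ E (refMap p u v x) v) v ^ 2) ≤
      4 * H ^ 2 * ∫ x in refTriangle, (sq2 (fderiv ℝ E (refMap p u v x) (1, 0)) +
        sq2 (fderiv ℝ E (refMap p u v x) (0, 1))) := by
    rw [← integral_const_mul]
    refine setIntegral_mono (Continuous.integrableOn_refTriangle (by fun_prop))
      (Continuous.integrableOn_refTriangle (by fun_prop)) fun x => ?_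
    have h1 := dot_apply_sq_le (fderiv ℝ E (refMap p u v x)) hu hu
    have h2 := dot_apply_sq_le (fderiv ℝ E (refMap p u v x)) hv hu
    have h3 := dot_apply_sq_le (fderiv ℝ E (refMap p u v x)) hu hv
    have h4 := dot_apply_sq_le (fderiv ℝ E (refMap p u v x)) hv hv
    simp only
    linarith
  have hH : 0 ≤ H := (sq2_nonneg u).trans hu
  have h1 := mul_le_mul_of_nonneg_left (key.trans (mul_le_mul_of_nonneg_left hright
    (by norm_num))) (by positivity : 0 ≤ 2 * H)
  have h2 := mul_le_mul_of_nonneg_left (hleft.trans h1) (abs_nonneg (refMapLinear u v).det)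
  linarith

lemma image_refMap_refTriangle (p : Fin 3 → ℝ × ℝ) :
    refMap (p 0) (p 1 - p 0) (p 2 - p 0) '' refTriangle = convexHull ℝ (Set.range p) := by
  apply Set.Subset.antisymm
  · rintro _ ⟨⟨s, t⟩, ⟨h1, h2, h3⟩, rfl⟩
    have hp : ∀ i, p i ∈ convexHull ℝ (Set.range p) := fun i =>
      subset_convexHull ℝ _ (Set.mem_range_self i)
    have hsum := (convex_convexHull ℝ (Set.range p)).sum_mem (t := Finset.univ)
      (w := ![1 - s - t, s, t]) (z := p)
      (by
        simp only at h1 h2 h3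
        intro i _
        fin_cases i <;> simp <;> linarith)
      (by simp only [Fin.sum_univ_three, Matrix.cons_val]; ring) (fun i _ => hp i)
    convert hsum using 1
    simp only [Fin.sum_univ_three, refMap]
    ext <;> simp <;> ring
  · refine convexHull_min ?_ ?_
    · rintro _ ⟨i, rfl⟩
      fin_cases i
      · exact ⟨(0, 0), by norm_num [refTriangle], by simp [refMap]⟩
      · exact ⟨(1, 0), by norm_num [refTriangle], by simp [refMap]⟩
      · exact ⟨(0, 1), by norm_num [refTriangle], by simp [refMap]⟩
    · have : refMap (p 0) (p 1 - p 0) (p 2 - p 0) '' refTriangle =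
          (fun x => p 0 + x) '' (refMapLinear (p 1 - p 0) (p 2 - p 0) '' refTriangle) := by
        rw [Set.image_image]
        rfl
      rw [this]
      exact (convex_refTriangle.is_linear_image
        (refMapLinear (p 1 - p 0) (p 2 - p 0)).toLinearMap.isLinear).translate _

lemma AffineIndependent.det_ne_zero {p : Fin 3 → ℝ × ℝ} (hp : AffineIndependent ℝ p) :
    (p 1 - p 0).1 * (p 2 - p 0).2 - (p 1 - p 0).2 * (p 2 - p 0).1 ≠ 0 := by
  intro h
  have key : ∀ w : Fin 3 → ℝ, w 0 + w 1 + w 2 = 0 → w 0 • p 0 + w 1 • p 1 + w 2 • p 2 = 0 →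
      ∀ i, w i = 0 := fun w h1 h2 i =>
    affineIndependent_iff.1 hp Finset.univ w (by simpa [Fin.sum_univ_three] using h1)
      (by simpa [Fin.sum_univ_three] using h2) i (Finset.mem_univ i)
  simp only [Prod.fst_sub, Prod.snd_sub] at h
  have k1 : ∀ x y : ℝ, x * ((p 1).1 - (p 0).1) + y * ((p 2).1 - (p 0).1) = 0 →
      x * ((p 1).2 - (p 0).2) + y * ((p 2).2 - (p 0).2) = 0 → x = 0 ∧ y = 0 := by
    intro x y h1 h2
    have := key ![-x - y, x, y] (by simp only [Matrix.cons_val]; ring) (by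
      ext
      · simp
        linarith
      · simp
        linarith)
    exact ⟨by simpa using this 1, by simpa using this 2⟩
  have a1 := (k1 ((p 2).2 - (p 0).2) (-((p 1).2 - (p 0).2)) (by linarith) (by ring)).2
  have a2 := (k1 ((p 2).1 - (p 0).1) (-((p 1).1 - (p 0).1)) (by ring) (by linarith)).2
  have := (k1 1 0 (by linarith) (by linarith)).1
  exact one_ne_zero this

lemma dot_self (w : ℝ × ℝ) : dot w w = sq2 w := by unfold dot sq2; ring

lemma le_ediam {K : Set (ℝ × ℝ)} (hK : IsCompact K) {x y : ℝ × ℝ} (hx : x ∈ K) (hy : y ∈ K) :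
    Real.sqrt (sq2 (x - y)) ≤ ediam K := by
  refine le_csSup ?_ ⟨x, hx, y, hy, by rw [dot_self]⟩
  have h := ((hK.prod hK).image_of_continuousOn (f := fun z : (ℝ × ℝ) × (ℝ × ℝ) =>
    Real.sqrt (dot (z.1 - z.2) (z.1 - z.2))) (Continuous.continuousOn (by fun_prop))).bddAbove
  refine h.mono ?_
  rintro d ⟨u, hu, v, hv, rfl⟩
  exact ⟨(u, v), ⟨hu, hv⟩, rfl⟩

/-- A Euclidean ball of radius `r` contained in a strip `0 ≤ det (w, · - p) ≤ D` satisfies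
`2 r |w| ≤ D`. -/
lemma two_mul_radius_mul_le {w p x : ℝ × ℝ} {r D : ℝ} (hr : 0 ≤ r)
    (h : ∀ y, Real.sqrt (dot (y - x) (y - x)) ≤ r →
      |w.1 * (y - p).2 - w.2 * (y - p).1 - D / 2| ≤ |D| / 2) :
    4 * r ^ 2 * sq2 w ≤ D ^ 2 := by
  rcases (sq2_nonneg w).eq_or_lt with hw | hw
  · rw [← hw, mul_zero]; positivity
  set l := Real.sqrt (sq2 w) with hl
  have hl0 : 0 < l := Real.sqrt_pos.2 hw
  have hl2 : l ^ 2 = sq2 w := Real.sq_sqrt hw.le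
  have hwl : w.1 ^ 2 + w.2 ^ 2 = l ^ 2 := hl2.symm
  have hmem : ∀ c : ℝ, c ^ 2 = r ^ 2 → Real.sqrt (dot ((x + (c / l) • (-w.2, w.1)) - x)
      ((x + (c / l) • (-w.2, w.1)) - x)) ≤ r := by
    intro c hc
    rw [add_sub_cancel_left]
    refine Real.sqrt_le_iff.2 ⟨hr, le_of_eq ?_⟩
    simp only [dot, Prod.smul_mk, smul_eq_mul]
    field_simp
    rw [add_comm, hwl, hc, mul_comm]
  have hval : ∀ c : ℝ, w.1 * (x + (c / l) • (-w.2, w.1) - p).2 -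
      w.2 * (x + (c / l) • (-w.2, w.1) - p).1 = w.1 * (x - p).2 - w.2 * (x - p).1 + c * l := by
    intro c
    simp only [Prod.fst_sub, Prod.snd_sub, Prod.fst_add, Prod.snd_add, Prod.smul_mk, smul_eq_mul]
    have : c * l = c / l * (w.1 ^ 2 + w.2 ^ 2) := by rw [hwl]; field_simp
    rw [this]
    ring
  have h1 := abs_le.1 (h _ (hmem r rfl))
  have h2 := abs_le.1 (h _ (hmem (-r) (neg_sq r)))
  rw [hval] at h1 h2
  have h3 : 2 * (r * l) ≤ |D| := by linarith [h1.2, h2.1]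
  calc 4 * r ^ 2 * sq2 w = (2 * (r * l)) ^ 2 := by rw [← hl2]; ring
    _ ≤ |D| ^ 2 := by gcongr
    _ = D ^ 2 := sq_abs D

/-- The inradius of a triangle is at most half the square root of its Jacobian. -/
lemma einrad_image_le {p u v : ℝ × ℝ} (hD : u.1 * v.2 - u.2 * v.1 ≠ 0) :
    einrad (refMap p u v '' refTriangle) ≤ Real.sqrt |u.1 * v.2 - u.2 * v.1| / 2 := by
  set D := u.1 * v.2 - u.2 * v.1 with hDdef
  refine Real.sSup_le ?_ (by positivity)
  rintro r ⟨hr, x, hx⟩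
  have hmem : ∀ y, Real.sqrt (dot (y - x) (y - x)) ≤ r → ∃ s t : ℝ, 0 ≤ s ∧ 0 ≤ t ∧ s + t ≤ 1 ∧
      y - p = s • u + t • v := by
    intro y hy
    obtain ⟨⟨s, t⟩, ⟨h1, h2, h3⟩, rfl⟩ := hx hy
    exact ⟨s, t, h1, h2, h3, add_sub_cancel_left _ _⟩
  have hhalf : ∀ c : ℝ, 0 ≤ c → c ≤ 1 → |c * D - D / 2| ≤ |D| / 2 := by
    intro c h0 h1
    have : c * D - D / 2 = (c - 1 / 2) * D := by ring
    have hc : |c - 1 / 2| ≤ 1 / 2 := abs_le.2 ⟨by linarith, by linarith⟩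
    rw [this, abs_mul]
    nlinarith [mul_le_mul_of_nonneg_right hc (abs_nonneg D)]
  have hu : 4 * r ^ 2 * sq2 u ≤ D ^ 2 := by
    refine two_mul_radius_mul_le (p := p) (x := x) hr fun y hy => ?_
    obtain ⟨s, t, h1, h2, h3, hst⟩ := hmem y hy
    rw [hst]
    convert hhalf t h2 (by linarith) using 2
    simp only [Prod.fst_add, Prod.snd_add, Prod.smul_fst, Prod.smul_snd, smul_eq_mul, hDdef]
    ring
  have hv : 4 * r ^ 2 * sq2 v ≤ D ^ 2 := by
    rw [← neg_sq D]
    refine two_mul_radius_mul_le (p := p) (x := x) hr fun y hy => ?_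
    obtain ⟨s, t, h1, h2, h3, hst⟩ := hmem y hy
    rw [hst, abs_neg, ← abs_neg]
    convert hhalf s h1 (by linarith) using 2
    simp only [Prod.fst_add, Prod.snd_add, Prod.smul_fst, Prod.smul_snd, smul_eq_mul, hDdef]
    ring
  have hDle : D ^ 2 ≤ sq2 u * sq2 v := by
    unfold sq2; nlinarith [sq_nonneg (u.1 * v.1 + u.2 * v.2)]
  have hD2 : 0 < D ^ 2 := by positivity
  have h16 : (4 * r ^ 2) ^ 2 ≤ D ^ 2 := by
    have h1 := mul_le_mul hu hv (mul_nonneg (by positivity) (sq2_nonneg v)) hD2.le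
    have h2 : (4 * r ^ 2) ^ 2 * D ^ 2 ≤ D ^ 2 * D ^ 2 := by
      nlinarith [mul_le_mul_of_nonneg_left hDle (sq_nonneg (4 * r ^ 2))]
    exact le_of_mul_le_mul_right h2 hD2
  have h4 : (2 * r) ^ 2 ≤ |D| := by
    have := sq_le_sq.1 h16
    rw [abs_of_nonneg (by positivity)] at this
    linarith
  linarith [Real.le_sqrt_of_sq_le h4]

/-- A `C¹` field on a neighborhood of a compact set agrees near that set with a global one. -/
lemma exists_contDiff_eventuallyEq {E : ℝ × ℝ → ℝ × ℝ} {K U : Set (ℝ × ℝ)} (hK : IsCompact K)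
    (hU : IsOpen U) (hKU : K ⊆ U) (hE : ContDiffOn ℝ 1 E U) :
    ∃ E' : ℝ × ℝ → ℝ × ℝ, ContDiff ℝ 1 E' ∧ ∀ x ∈ K, E' =ᶠ[nhds x] E := by
  obtain ⟨L, hL, hKL, hLU⟩ := exists_compact_between hK hU hKU
  obtain ⟨χ, h1, h0, -⟩ := exists_contMDiffMap_one_nhds_of_subset_interior (n := 1)
    (modelWithCornersSelf ℝ (ℝ × ℝ)) hK.isClosed hKL
  have hχ : ContDiff ℝ 1 χ := χ.contMDiff.contDiff
  refine ⟨fun x => χ x • E x, contDiff_iff_contDiffAt.2 fun x => ?_, fun x hx => ?_⟩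
  · by_cases hx : x ∈ U
    · exact hχ.contDiffAt.smul (hE.contDiffAt (hU.mem_nhds hx))
    · refine (contDiffAt_const (c := 0)).congr_of_eventuallyEq ?_
      filter_upwards [hL.isClosed.isOpen_compl.mem_nhds fun h => hx (hLU h)] with y hy
      rw [h0 y hy, zero_smul]
  · filter_upwards [h1.filter_mono (nhds_le_nhdsSet hx)] with y hy
    rw [hy, one_smul]

/-- For every `γ ≥ 1` there is a constant `C` such that for every
nondegenerate triangle `K` with `h_K/ρ_K ≤ γ` and every C¹ vector field `E` on a
neighborhood of `K`, the lowest-order Nédélec interpolant `Π_K E = a + b(−y,x)ᵀ`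
satisfies `‖E − Π_K E‖_{L²(K)} ≤ C h_K ‖E‖_{H¹(K)}`. -/
theorem stmt_16 :
    ∀ γ : ℝ, 1 ≤ γ →
      ∃ C : ℝ,
        ∀ (p : Fin 3 → ℝ × ℝ), AffineIndependent ℝ p →
        ∀ (K : Set (ℝ × ℝ)), K = convexHull ℝ (Set.range p) →
        ediam K ≤ γ * einrad K →
        ∀ (U : Set (ℝ × ℝ)), IsOpen U → K ⊆ U →
        ∀ (E : ℝ × ℝ → ℝ × ℝ), ContDiffOn ℝ 1 E U →
        ∀ (a : ℝ × ℝ) (b : ℝ) (PE : ℝ × ℝ → ℝ × ℝ),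
          (∀ x : ℝ × ℝ, PE x = (a.1 - b * x.2, a.2 + b * x.1)) →
          (∀ i : Fin 3,
            edgeInt PE (p (i + 1)) (p (i + 2)) = edgeInt E (p (i + 1)) (p (i + 2))) →
        Real.sqrt (∫ x in K, sq2 (E x - PE x))
          ≤ C * ediam K *
            Real.sqrt (∫ x in K,
              sq2 (E x) + sq2 (fderiv ℝ E x (1, 0)) + sq2 (fderiv ℝ E x (0, 1))) := by
  intro γ hγ
  refine ⟨3 * γ ^ 2, ?_⟩
  rintro p hp K rfl hh U hU hKU E hE a b PE hPE hedge
  have himg := image_refMap_refTriangle p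
  have hD := hp.det_ne_zero
  set K := convexHull ℝ (Set.range p) with hKdef
  set u := p 1 - p 0 with hu
  set v := p 2 - p 0 with hv
  set D := u.1 * v.2 - u.2 * v.1 with hDdef
  have hK : IsCompact K := (Set.finite_range p).isCompact_convexHull ℝ
  have hpK : ∀ i, p i ∈ K := fun i => subset_convexHull ℝ _ (Set.mem_range_self i)
  obtain ⟨E', hE', hEE'⟩ := exists_contDiff_eventuallyEq hK hU hKU hE
  have hE'c := hE'.continuous
  have hPEc : Continuous PE := by rw [funext hPE]; fun_prop
  have hedge' : ∀ i : Fin 3, ∫ s in (0 : ℝ)..1,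
      dot ((E' - PE) (p (i + 1) + s • (p (i + 2) - p (i + 1)))) (p (i + 2) - p (i + 1)) = 0 := by
    intro i
    have h1 : edgeInt E (p (i + 1)) (p (i + 2)) = edgeInt E' (p (i + 1)) (p (i + 2)) := by
      refine intervalIntegral.integral_congr fun s hs => ?_
      rw [Set.uIcc_of_le zero_le_one] at hs
      have hmem := (convex_convexHull ℝ (Set.range p)).add_smul_sub_mem (hpK (i + 1))
        (hpK (i + 2)) hs
      simp only [(hEE' _ hmem).eq_of_nhds]
    have h2 := hedge i
    rw [h1, eq_comm, ← sub_eq_zero] at h2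
    unfold edgeInt at h2
    rw [← intervalIntegral.integral_sub (Continuous.intervalIntegrable (by fun_prop) _ _)
      (Continuous.intervalIntegrable (by fun_prop) _ _)] at h2
    refine Eq.trans ?_ h2
    refine intervalIntegral.integral_congr fun s _ => ?_
    simp only [dot, Pi.sub_apply, Prod.fst_sub, Prod.snd_sub]
    ring
  have he₁ : ∫ s in (0 : ℝ)..1, dot ((E' - PE) (refMap (p 0) u v (s, 0))) u = 0 := by
    refine Eq.trans ?_ (hedge' 2)
    refine intervalIntegral.integral_congr fun s _ => ?_
    simp [refMap, hu]
  have he₂ : ∫ t in (0 : ℝ)..1, dot ((E' - PE) (refMap (p 0) u v (0, t))) v = 0 := by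
    have h1 := intervalIntegral.integral_comp_sub_left (a := 0) (b := 1)
      (fun t => dot ((E' - PE) (refMap (p 0) u v (0, t))) v) 1
    simp only [sub_self, sub_zero] at h1
    rw [← h1, ← neg_eq_zero, ← intervalIntegral.integral_neg]
    refine Eq.trans ?_ (hedge' 1)
    refine intervalIntegral.integral_congr fun t _ => ?_
    have h2 : refMap (p 0) u v (0, 1 - t) = p (1 + 1) + t • (p (1 + 2) - p (1 + 1)) := by
      change p 0 + ((0 : ℝ) • u + (1 - t) • (p 2 - p 0)) = p 2 + t • (p 0 - p 2)
      module
    have h3 : p (1 + 2) - p (1 + 1) = -v := by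
      change p 0 - p 2 = -(p 2 - p 0)
      abel
    simp only [h2]
    rw [h3]
    simp only [dot, Prod.fst_neg, Prod.snd_neg]
    ring
  have he₃ : ∫ t in (0 : ℝ)..1, dot ((E' - PE) (refMap (p 0) u v (1 - t, t))) (v - u) = 0 := by
    refine Eq.trans ?_ (hedge' 0)
    refine intervalIntegral.integral_congr fun t _ => ?_
    have h2 : refMap (p 0) u v (1 - t, t) = p (0 + 1) + t • (p (0 + 2) - p (0 + 1)) := by
      change p 0 + ((1 - t) • (p 1 - p 0) + t • (p 2 - p 0)) = p 1 + t • (p 2 - p 1)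
      module
    have h3 : p (0 + 2) - p (0 + 1) = v - u := by
      change p 2 - p 1 = p 2 - p 0 - (p 1 - p 0)
      abel
    simp only [h2]
    rw [h3]
  set h := ediam K with hhdef
  have hlen : ∀ i j, sq2 (p i - p j) ≤ h ^ 2 := fun i j =>
    (Real.sqrt_le_iff.1 (le_ediam hK (hpK i) (hpK j))).2
  have hh0 : 0 ≤ h := (Real.sqrt_nonneg _).trans (le_ediam hK (hpK 0) (hpK 0))
  have hreg : 4 * h ^ 2 ≤ γ ^ 2 * |D| := by
    have h1 := einrad_image_le (p := p 0) hD
    rw [himg] at h1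
    have h2 : 2 * h ≤ γ * Real.sqrt |D| := by nlinarith
    calc 4 * h ^ 2 = (2 * h) ^ 2 := by ring
      _ ≤ (γ * Real.sqrt |D|) ^ 2 := by gcongr
      _ = γ ^ 2 * |D| := by rw [mul_pow, Real.sq_sqrt (abs_nonneg D)]
  have key := nedelec_estimate_image hE' hPE (hlen 1 0) (hlen 2 0) hD he₁ he₂ he₃
  rw [himg] at key
  have hKm := hK.measurableSet
  have hleft : ∫ x in K, sq2 (E x - PE x) = ∫ x in K, sq2 (E' x - PE x) :=
    setIntegral_congr_fun hKm fun x hx => by simp only [(hEE' x hx).eq_of_nhds]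
  have hright : ∫ x in K, sq2 (E x) + sq2 (fderiv ℝ E x (1, 0)) + sq2 (fderiv ℝ E x (0, 1)) =
      ∫ x in K, (sq2 (E' x) + sq2 (fderiv ℝ E' x (1, 0)) + sq2 (fderiv ℝ E' x (0, 1))) :=
    setIntegral_congr_fun hKm fun x hx => by
      simp only [(hEE' x hx).eq_of_nhds, (hEE' x hx).fderiv_eq]
  have hE'd : ∀ w, Continuous fun x => fderiv ℝ E' x w := fun w =>
    (hE'.continuous_fderiv one_ne_zero).clm_apply continuous_const
  have hE'd1 := hE'd (1, 0)
  have hE'd2 := hE'd (0, 1)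
  set N := ∫ x in K, (sq2 (E' x) + sq2 (fderiv ℝ E' x (1, 0)) + sq2 (fderiv ℝ E' x (0, 1)))
    with hN
  set Q := ∫ x in K, (sq2 (fderiv ℝ E' x (1, 0)) + sq2 (fderiv ℝ E' x (0, 1))) with hQ
  have hQ0 : 0 ≤ Q := integral_nonneg fun x => add_nonneg (sq2_nonneg _) (sq2_nonneg _)
  have hQN : Q ≤ N :=
    setIntegral_mono ((Continuous.continuousOn (by fun_prop)).integrableOn_compact hK)
      ((Continuous.continuousOn (by fun_prop)).integrableOn_compact hK)
      fun x => by simp only; linarith [sq2_nonneg (E' x)]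
  have hbound : ∫ x in K, sq2 (E' x - PE x) ≤ (3 * γ ^ 2 * h) ^ 2 * N := by
    refine le_trans ?_ (mul_le_mul_of_nonneg_left hQN (sq_nonneg _))
    refine le_of_mul_le_mul_left (key.trans ?_) (by positivity : 0 < D ^ 2)
    have h1 : (4 * h ^ 2) ^ 2 ≤ (γ ^ 2 * |D|) ^ 2 := by gcongr
    rw [mul_pow _ |D|, sq_abs] at h1
    nlinarith [mul_le_mul_of_nonneg_right h1 (mul_nonneg (sq_nonneg h) hQ0)]
  rw [hleft, hright]
  calc Real.sqrt (∫ x in K, sq2 (E' x - PE x)) ≤ Real.sqrt ((3 * γ ^ 2 * h) ^ 2 * N) :=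
        Real.sqrt_le_sqrt hbound
    _ = 3 * γ ^ 2 * h * Real.sqrt N := by
        rw [Real.sqrt_mul (sq_nonneg _), Real.sqrt_sq (by positivity)]
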